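/- For integers x and l, define q_{x,l}(r,m,n,s) = 10m^2 + 2x*mn + l*n^2 - 2rs and phi_x(r,m,n,s) = (-r + s, 2r + 10m + x*n + 2s) on ZZ^4. Then for every pair of coprime integers (p,q) there exist a pair (x,l), with either (l = 2 and x >= 6) or (x,l) in {(5,0), (7,4), (9,4)}, and a vector w in ZZ^4 such that phi_x(w) = (p,q) and q_{x,l}(w) >= -2. -/

import Mathlib

/-- The Mukai square `q_{x,l}(r,m,n,s) = 10m² + 2x·mn + l·n² - 2rs`. -/
def gmQ (x l : ℤ) (w : ℤ × ℤ × ℤ × ℤ) : ℤ :=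
  10 * w.2.1 ^ 2 + 2 * x * w.2.1 * w.2.2.1 + l * w.2.2.1 ^ 2 - 2 * w.1 * w.2.2.2

/-- The induced map `φ_x(r,m,n,s) = (-r + s, 2r + 10m + x·n + 2s)`. -/
def gmPhi (x : ℤ) (w : ℤ × ℤ × ℤ × ℤ) : ℤ × ℤ :=
  (-w.1 + w.2.2.2, 2 * w.1 + 10 * w.2.1 + x * w.2.2.1 + 2 * w.2.2.2)

/-- Combined lattice-theoretic content of Lemmas 6.6, 6.7, 6.8: for every
coprime pair `(p,q)` there are admissible `(x,l)` and `w ∈ ℤ⁴` with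
`φ_x(w) = (p,q)` and `q_{x,l}(w) ≥ -2`. -/
theorem gm_lift_exists (p q : ℤ) (hpq : Int.gcd p q = 1) :
    ∃ (x l : ℤ) (w : ℤ × ℤ × ℤ × ℤ),
      ((l = 2 ∧ 6 ≤ x) ∨ (x, l) ∈ ({(5, 0), (7, 4), (9, 4)} : Set (ℤ × ℤ))) ∧
      gmPhi x w = (p, q) ∧ gmQ x l w ≥ -2 := by
  rcases Int.even_or_odd' p with ⟨a, ha | ha⟩ <;> rcases Int.even_or_odd' q with ⟨b, hb | hb⟩
  · exfalso
    have h2 : (2 : ℤ) ∣ (Int.gcd p q : ℤ) :=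
      Int.dvd_coe_gcd (Dvd.intro a ha.symm) (Dvd.intro b hb.symm)
    rw [hpq] at h2
    norm_num at h2
  · refine ⟨7, 4, (-q - a - 2, b + 2, -1, p + (-q - a - 2)), by simp, ?_, ?_⟩
    · simp only [gmPhi, Prod.mk.injEq]
      constructor <;> linarith
    · simp only [gmQ]
      subst ha hb
      have h : 0 ≤ b * (b + 1) := by
        rcases le_or_gt 0 b with h | h <;> nlinarith
      nlinarith [sq_nonneg a]
  · refine ⟨7, 4, (-q - a - 3, b + 1, 0, p + (-q - a - 3)), by simp, ?_, ?_⟩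
    · simp only [gmPhi, Prod.mk.injEq]
      constructor <;> linarith
    · simp only [gmQ]
      subst ha hb
      have h : 0 ≤ a * (a + 1) := by
        rcases le_or_gt 0 a with h | h <;> nlinarith
      nlinarith [sq_nonneg b]
  · refine ⟨7, 4, (-q - a - 1, b, 1, p + (-q - a - 1)), by simp, ?_, ?_⟩
    · simp only [gmPhi, Prod.mk.injEq]
      constructor <;> linarith
    · simp only [gmQ]
      subst ha hb
      nlinarith [sq_nonneg (2 * a + 1), sq_nonneg (2 * b + 1)]
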